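/- arXiv:1503.02418 — 3 statements merged into one kernel-verified Lean document; each statement's English description precedes it below -/
import Mathlib

section
/- Let a < b and let z = (u,λ) : ℝ → H × ℝ be a C¹ solution of the negative gradient flow z'(t) = −∇I(z(t)) (explicitly, u'(t) = u(t)⁻ − u(t)⁺ + λ(t)|L|⁻¹∇F(u(t)) and λ'(t) = F(u(t))) such that a ≤ I(z(t)) ≤ b for all t ∈ ℝ. Then there is a constant C depending only on a, b, E, L and F (and not on z) such that |λ(t)| ≤ C and ‖u(t)‖_H ≤ C for all t ∈ ℝ. -/
noncomputable section

open scoped RealInnerProductSpace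
open Filter Topology Bornology MeasureTheory

/-- Index set `ℤ ∖ {0}` for the eigenbasis. -/
abbrev Idx : Type := {i : ℤ // i ≠ 0}

variable {E : Type*} [NormedAddCommGroup E] [InnerProductSpace ℝ E] [CompleteSpace E]

/-- `i`-th coordinate `⟨u, φ_i⟩` of `u` in the orthonormal (Hilbert) basis `b`. -/
def rfCoord (b : HilbertBasis Idx ℝ E) (u : E) (i : Idx) : ℝ := b.repr u i

/-- `u ∈ H`, i.e. `Σ_i |λ_i| ⟨u,φ_i⟩² < ∞`. -/
def rfMemH (b : HilbertBasis Idx ℝ E) (lam : Idx → ℝ) (u : E) : Prop :=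
  Summable fun i : Idx => |lam i| * (rfCoord b u i) ^ 2

/-- The `H` inner product `⟨u,v⟩_H = Σ_i |λ_i| ⟨u,φ_i⟩⟨v,φ_i⟩`. -/
def rfInnerH (b : HilbertBasis Idx ℝ E) (lam : Idx → ℝ) (u v : E) : ℝ :=
  ∑' i : Idx, |lam i| * (rfCoord b u i) * (rfCoord b v i)

/-- The `H` norm `‖u‖_H = (Σ_i |λ_i| ⟨u,φ_i⟩²)^{1/2}`. -/
def rfNormH (b : HilbertBasis Idx ℝ E) (lam : Idx → ℝ) (u : E) : ℝ :=
  Real.sqrt (∑' i : Idx, |lam i| * (rfCoord b u i) ^ 2)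

/-- The quadratic form `⟨Lu,u⟩ = Σ_i λ_i ⟨u,φ_i⟩²`. -/
def rfLquad (b : HilbertBasis Idx ℝ E) (lam : Idx → ℝ) (u : E) : ℝ :=
  ∑' i : Idx, lam i * (rfCoord b u i) ^ 2

/-- `u⁺`: orthogonal projection onto the closed span of `{φ_i : i > 0}`. -/
def rfPos (b : HilbertBasis Idx ℝ E) (u : E) : E :=
  ∑' i : Idx, (if 0 < (i : ℤ) then rfCoord b u i else 0) • (b i : E)

/-- `u⁻`: orthogonal projection onto the closed span of `{φ_i : i < 0}`. -/
def rfNeg (b : HilbertBasis Idx ℝ E) (u : E) : E :=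
  ∑' i : Idx, (if (i : ℤ) < 0 then rfCoord b u i else 0) • (b i : E)

/-- `|L|⁻¹ w = Σ_i |λ_i|⁻¹ ⟨w,φ_i⟩ φ_i`. -/
def rfAbsLinv (b : HilbertBasis Idx ℝ E) (lam : Idx → ℝ) (w : E) : E :=
  ∑' i : Idx, (|lam i|⁻¹ * rfCoord b w i) • (b i : E)

/-- The Rabinowitz functional `I(u,λ) = ½⟨Lu,u⟩ − λ F(u)`. -/
def rfI (b : HilbertBasis Idx ℝ E) (lam : Idx → ℝ) (F : E → ℝ) (u : E) (l : ℝ) : ℝ :=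
  (1 / 2) * rfLquad b lam u - l * F u

/-- First (`H`-)component of `∇I(u,λ)`: `u⁺ − u⁻ − λ |L|⁻¹ ∇F(u)`. -/
def rfGrad1 (b : HilbertBasis Idx ℝ E) (lam : Idx → ℝ) (F : E → ℝ) (u : E) (l : ℝ) : E :=
  rfPos b u - rfNeg b u - l • rfAbsLinv b lam (gradient F u)

/-- `‖∇I(u,λ)‖_ℋ = (‖u⁺ − u⁻ − λ|L|⁻¹∇F(u)‖_H² + F(u)²)^{1/2}`. -/
def rfGradNorm (b : HilbertBasis Idx ℝ E) (lam : Idx → ℝ) (F : E → ℝ) (u : E) (l : ℝ) : ℝ :=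
  Real.sqrt ((rfNormH b lam (rfGrad1 b lam F u l)) ^ 2 + (F u) ^ 2)

/-- A (possibly nonlinear) map is compact: continuous and mapping bounded sets to
relatively compact sets. -/
def rfCompactMap {X Y : Type*} [NormedAddCommGroup X] [NormedAddCommGroup Y] (f : X → Y) : Prop :=
  Continuous f ∧ ∀ s : Set X, IsBounded s → IsCompact (closure (f '' s))

/-- Hypothesis (F1): `u ↦ |L|⁻¹ ∇F(u)` is a compact map from `E` to `E`. -/
def rfF1 (b : HilbertBasis Idx ℝ E) (lam : Idx → ℝ) (F : E → ℝ) : Prop :=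
  rfCompactMap fun u : E => rfAbsLinv b lam (gradient F u)

/-- Hypothesis (F2): there are `R, a, δ > 0` such that `|F(u)| ≤ δ` implies
`‖u‖_E ≤ R` and `⟨∇F(u),u⟩ ≥ a`. -/
def rfF2 (F : E → ℝ) : Prop :=
  ∃ R a δ : ℝ, 0 < R ∧ 0 < a ∧ 0 < δ ∧
    ∀ u : E, |F u| ≤ δ → ‖u‖ ≤ R ∧ a ≤ ⟪gradient F u, u⟫

/-- Hypotheses on the eigenvalues: all nonzero, `λ_i > 0 ↔ i > 0`, `|λ_i| → ∞`. -/
def rfLam (lam : Idx → ℝ) : Prop :=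
  (∀ i : Idx, lam i ≠ 0) ∧ (∀ i : Idx, 0 < lam i ↔ 0 < (i : ℤ)) ∧
    Tendsto (fun i : Idx => |lam i|) cofinite atTop

/-- `u : ℝ → E` has derivative `du` at `t` in the `H`-norm. -/
def rfHasHDerivAt (b : HilbertBasis Idx ℝ E) (lam : Idx → ℝ) (u : ℝ → E) (du : E) (t : ℝ) :
    Prop :=
  Tendsto (fun h : ℝ => rfNormH b lam (u (t + h) - u t - h • du) / |h|) (𝓝[≠] 0) (𝓝 0)

/-- The negative gradient flow vector field (first component):
`u⁻ − u⁺ + λ |L|⁻¹ ∇F(u)`. -/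
def rfFlowVec (b : HilbertBasis Idx ℝ E) (lam : Idx → ℝ) (F : E → ℝ) (u : E) (l : ℝ) : E :=
  rfNeg b u - rfPos b u + l • rfAbsLinv b lam (gradient F u)


/-- A function whose derivative is at least `κ` on `[s, t]` increases by at least `κ * (t - s)`. -/
lemma mul_sub_le_of_hasDerivAt {g g' : ℝ → ℝ} (hg : ∀ r, HasDerivAt g (g' r) r) {s t κ : ℝ}
    (hst : s ≤ t) (h : ∀ r ∈ Set.Icc s t, κ ≤ g' r) : κ * (t - s) ≤ g t - g s := by
  refine Convex.mul_sub_le_image_sub_of_le_deriv (convex_Icc s t)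
    (fun r _ => (hg r).continuousAt.continuousWithinAt)
    (fun r _ => (hg r).differentiableAt.differentiableWithinAt) (fun r hr => ?_)
    s (Set.left_mem_Icc.2 hst) t (Set.right_mem_Icc.2 hst) hst
  rw [(hg r).deriv]
  exact h r (interior_subset hr)

/-- If the squared speed of a curve is dominated by the dissipation of a quantity with values
in `[a, b]`, then the curve is Hölder continuous of exponent `1/2`. -/
lemma norm_sub_le_sqrt_of_dissipation {V : Type*} [NormedAddCommGroup V] [NormedSpace ℝ V]
    {f f' : ℝ → V} {I e : ℝ → ℝ} {a b : ℝ} (hab : a < b) (hf : ∀ t, HasDerivAt f (f' t) t)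
    (hI : ∀ t, HasDerivAt I (-e t) t) (he : ∀ t, ‖f' t‖ ^ 2 ≤ e t)
    (hIab : ∀ t, a ≤ I t ∧ I t ≤ b) (s t : ℝ) :
    ‖f t - f s‖ ≤ √((b - a) * |t - s|) := by
  wlog hst : s ≤ t generalizing s t
  · rw [norm_sub_rev, abs_sub_comm]
    exact this t s (le_of_not_ge hst)
  rcases hst.eq_or_lt with rfl | hlt
  · simp
  rw [abs_of_pos (sub_pos.2 hlt)]
  have hA : 0 < b - a := sub_pos.2 hab
  have hT : 0 < t - s := sub_pos.2 hlt
  set x := √(t - s)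
  set y := √(b - a)
  have hx : 0 < x := Real.sqrt_pos.2 hT
  have hy : 0 < y := Real.sqrt_pos.2 hA
  have hx2 : x ^ 2 = t - s := Real.sq_sqrt hT.le
  have hy2 : y ^ 2 = b - a := Real.sq_sqrt hA.le
  have key := image_norm_le_of_norm_deriv_right_le_deriv_boundary (a := s) (b := t)
    (f := fun r => f r - f s) (f' := f')
    (fun r _ => ((hf r).sub_const _).continuousAt.continuousWithinAt)
    (fun r _ => ((hf r).sub_const _).hasDerivWithinAt)
    (B := fun r => x / y / 2 * (I s - I r) + y / x / 2 * (r - s))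
    (B' := fun r => x / y / 2 * e r + y / x / 2) (by simp)
    (fun r => by
      have h1 := ((hI r).const_sub (I s)).const_mul (x / y / 2)
      have h2 := ((hasDerivAt_id r).sub_const s).const_mul (y / x / 2)
      exact (h1.add h2).congr_deriv (by simp))
    (fun r _ => by
      have h1 : x / y / 2 * ‖f' r‖ ^ 2 ≤ x / y / 2 * e r := by
        gcongr
        exact he r
      have h2 : x / y / 2 * ‖f' r‖ ^ 2 + y / x / 2 - ‖f' r‖
          = (x * ‖f' r‖ - y) ^ 2 / (2 * x * y) := by
        field_simp
        ring
      have h3 : 0 ≤ (x * ‖f' r‖ - y) ^ 2 / (2 * x * y) := by positivity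
      linarith)
    (Set.right_mem_Icc.2 hst)
  have h4 : x / y / 2 * (I s - I t) ≤ x / y / 2 * y ^ 2 := by
    gcongr
    linarith [(hIab s).2, (hIab t).1]
  have h5 : x / y / 2 * y ^ 2 + y / x / 2 * x ^ 2 = y * x := by
    field_simp
    ring
  rw [Real.sqrt_mul hA.le]
  have h6 : ‖f t - f s‖ ≤ x / y / 2 * (I s - I t) + y / x / 2 * x ^ 2 := by
    rw [hx2]
    exact key
  linarith

/-- A bounded solution of `f' = -f + m • k`, with `k` in a closed convex symmetric set `K` and `m`
growing at most linearly backwards from time `t`, lies at time `t` in a multiple of `K`. -/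
lemma smul_mem_of_bounded_of_hasDerivAt {V : Type*} [NormedAddCommGroup V] [NormedSpace ℝ V]
    {K : Set V} (hconv : Convex ℝ K) (hclosed : IsClosed K) (hneg : ∀ x ∈ K, -x ∈ K)
    (hzero : (0 : V) ∈ K) {f k : ℝ → V} {m : ℝ → ℝ} {B α β t : ℝ} (hα : 0 < α) (hβ : 0 ≤ β)
    (hB : ∀ s, ‖f s‖ ≤ B) (hf : ∀ s, HasDerivAt f (m s • k s - f s) s) (hk : ∀ s, k s ∈ K)
    (hm : ∀ s ≤ t, |m s| ≤ α + β * (t - s)) : (α + β)⁻¹ • f t ∈ K := by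
  by_contra hcon
  obtain ⟨φ, c, hφK, hφt⟩ := geometric_hahn_banach_closed_point hconv hclosed hcon
  have hc : 0 < c := by simpa using hφK 0 hzero
  have hM : 0 < α + β := by positivity
  rw [map_smul, smul_eq_mul, lt_inv_mul_iff₀ hM] at hφt
  have hφk : ∀ s, |φ (k s)| ≤ c := fun s =>
    abs_le.2 ⟨by linarith [hφK _ (hneg _ (hk s)), map_neg φ (k s)], (hφK _ (hk s)).le⟩
  have hp : ∀ s, HasDerivAt (fun r => φ (f r)) (m s * φ (k s) - φ (f s)) s := fun s => by
    exact (φ.hasFDerivAt.comp_hasDerivAt s (hf s)).congr_deriv (by simp)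
  set q : ℝ → ℝ := fun s => Real.exp (s - t) * (c * (α + β * (t - s) + β) - φ (f s)) with hq
  have hqd : ∀ s, HasDerivAt q
      (Real.exp (s - t) * (c * (α + β * (t - s)) - m s * φ (k s))) s := fun s => by
    have h1 : HasDerivAt (fun r => Real.exp (r - t)) (Real.exp (s - t)) s := by
      simpa using ((hasDerivAt_id s).sub_const t).exp
    have h2 : HasDerivAt (fun r => c * (α + β * (t - r) + β)) (c * -β) s := by
      have := (((((hasDerivAt_id s).const_sub t).const_mul β).const_add α).add_const β).const_mul c
      simpa using this
    refine (h1.mul (h2.sub (hp s))).congr_deriv ?_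
    simp only [Pi.sub_apply]
    ring
  have hmono : ∀ s ≤ t, q s ≤ q t := fun s hs => by
    have := mul_sub_le_of_hasDerivAt hqd hs (κ := 0) (fun r hr => by
      have h1 := hm r hr.2
      have h2 : m r * φ (k r) ≤ (α + β * (t - r)) * c := by
        refine (le_abs_self _).trans ?_
        rw [abs_mul]
        exact mul_le_mul h1 (hφk r) (abs_nonneg _) ((abs_nonneg _).trans h1)
      have h3 : 0 ≤ c * (α + β * (t - r)) - m r * φ (k r) := by linarith
      positivity)
    linarith
  have hqt : q t < 0 := by
    simp only [hq, sub_self, Real.exp_zero, mul_zero, add_zero, one_mul]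
    linarith
  have hlow : ∀ s ≤ t, -(Real.exp (s - t) * (‖φ‖ * B)) ≤ q t := fun s hs => by
    refine le_trans ?_ (hmono s hs)
    simp only [hq]
    have h1 : φ (f s) ≤ ‖φ‖ * B := (le_abs_self _).trans
      ((φ.le_opNorm _).trans (mul_le_mul_of_nonneg_left (hB s) (norm_nonneg _)))
    have h2 : 0 ≤ c * (α + β * (t - s) + β) := by
      have := sub_nonneg.2 hs
      positivity
    rw [← mul_neg]
    gcongr
    linarith
  have hlim : Tendsto (fun s => -(Real.exp (s - t) * (‖φ‖ * B))) atBot (𝓝 0) := by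
    have h1 : Tendsto (fun s : ℝ => Real.exp (s - t)) atBot (𝓝 0) :=
      Real.tendsto_exp_atBot.comp (tendsto_atBot_add_const_right _ _ tendsto_id)
    simpa using (h1.mul_const (‖φ‖ * B)).neg
  have := le_of_tendsto hlim ((eventually_le_atBot t).mono hlow)
  linarith

section AbstractFlow

variable {V : Type*} [NormedAddCommGroup V] [InnerProductSpace ℝ V]

/-- Algebraic properties of the splitting `J` and the smoothing operator `S`. -/
structure IsSplitting (J S : V →L[ℝ] V) : Prop where
  symm : ∀ x y, ⟪J x, y⟫ = ⟪x, J y⟫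
  invol : ∀ x, J (J x) = x
  smooth_symm : ∀ x y, ⟪S x, y⟫ = ⟪x, S y⟫
  comm : ∀ x, S (J x) = J (S x)

lemma IsSplitting.neg {J S : V →L[ℝ] V} (h : IsSplitting J S) : IsSplitting (-J) S where
  symm x y := by simp [h.symm]
  invol x := by simp [h.invol]
  smooth_symm := h.smooth_symm
  comm x := by simp [h.comm]

lemma IsSplitting.inner_map_map {J S : V →L[ℝ] V} (h : IsSplitting J S) (x y : V) :
    ⟪J x, J y⟫ = ⟪x, y⟫ := by
  rw [h.symm, h.invol]

lemma IsSplitting.norm_map {J S : V →L[ℝ] V} (h : IsSplitting J S) (x : V) : ‖J x‖ = ‖x‖ := by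
  rw [norm_eq_sqrt_real_inner, h.inner_map_map, ← norm_eq_sqrt_real_inner]

variable [CompleteSpace V]

/-- Negative gradient flow of `(w, l) ↦ ½⟪J w, w⟫ - l * F (S w)` with action in `[a, b]`. -/
structure IsBoundedFlow (J S : V →L[ℝ] V) (F : V → ℝ) (a b : ℝ) (w : ℝ → V) (l : ℝ → ℝ) :
    Prop where
  deriv_fst : ∀ t, HasDerivAt w (l t • S (gradient F (S (w t))) - J (w t)) t
  deriv_snd : ∀ t, HasDerivAt l (F (S (w t))) t
  action_mem : ∀ t, a ≤ (1 / 2) * ⟪J (w t), w t⟫ - l t * F (S (w t)) ∧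
    (1 / 2) * ⟪J (w t), w t⟫ - l t * F (S (w t)) ≤ b

/-- Reversing time exchanges the two parts of the splitting. -/
lemma IsBoundedFlow.reverse {J S : V →L[ℝ] V} {F : V → ℝ} {a b : ℝ} {w : ℝ → V} {l : ℝ → ℝ}
    (h : IsBoundedFlow J S F a b w l) :
    IsBoundedFlow (-J) S F (-b) (-a) (fun t => w (-t)) (fun t => -l (-t)) where
  deriv_fst t := by
    have := (h.deriv_fst (-t)).scomp t (hasDerivAt_neg t)
    refine this.congr_deriv ?_
    simp only [neg_apply]
    module
  deriv_snd t := by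
    have := ((h.deriv_snd (-t)).scomp t (hasDerivAt_neg t)).neg
    exact this.congr_deriv (by simp)
  action_mem t := by
    have := h.action_mem (-t)
    simp only [neg_apply, inner_neg_left]
    constructor <;> linarith

namespace IsBoundedFlow

variable {J S : V →L[ℝ] V} {F : V → ℝ} {a b : ℝ} {w : ℝ → V} {l : ℝ → ℝ}

lemma hasDerivAt_smooth (h : IsBoundedFlow J S F a b w l) (hJS : IsSplitting J S) (t : ℝ) :
    HasDerivAt (fun s => S (w s)) (l t • S (S (gradient F (S (w t)))) - J (S (w t))) t := by
  exact (S.hasFDerivAt.comp_hasDerivAt t (h.deriv_fst t)).congr_deriv (by simp [hJS.comm])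

/-- Energy identity. -/
lemma hasDerivAt_action (h : IsBoundedFlow J S F a b w l) (hJS : IsSplitting J S)
    (hF : Differentiable ℝ F) (t : ℝ) :
    HasDerivAt (fun s => (1 / 2) * ⟪J (w s), w s⟫ - l s * F (S (w s)))
      (-(‖l t • S (gradient F (S (w t))) - J (w t)‖ ^ 2 + F (S (w t)) ^ 2)) t := by
  have hw := h.deriv_fst t
  set w' := l t • S (gradient F (S (w t))) - J (w t) with hw'
  have h1 := (J.hasFDerivAt.comp_hasDerivAt t hw).inner ℝ hw
  have h2 := (hF (S (w t))).hasGradientAt.hasFDerivAt.comp_hasDerivAt t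
    (S.hasFDerivAt.comp_hasDerivAt t hw)
  refine ((h1.const_mul (1 / 2)).sub ((h.deriv_snd t).mul h2)).congr_deriv ?_
  have h3 : ⟪J w', w t⟫ = ⟪J (w t), w'⟫ := by rw [hJS.symm, real_inner_comm]
  have h4 : ⟪w', w'⟫ = l t * ⟪gradient F (S (w t)), S w'⟫ - ⟪J (w t), w'⟫ := by
    conv_lhs => rw [hw', ← hw']
    rw [inner_sub_left, inner_smul_left, hJS.smooth_symm]
    simp
  rw [real_inner_self_eq_norm_sq] at h4
  simp only [Function.comp_apply, InnerProductSpace.toDual_apply_apply]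
  rw [h3, h4]
  ring

lemma norm_sub_le (h : IsBoundedFlow J S F a b w l) (hJS : IsSplitting J S)
    (hF : Differentiable ℝ F) (hab : a < b) (s t : ℝ) :
    ‖w t - w s‖ ≤ √((b - a) * |t - s|) :=
  norm_sub_le_sqrt_of_dissipation hab h.deriv_fst (h.hasDerivAt_action hJS hF)
    (fun t => by nlinarith [sq_nonneg (F (S (w t)))]) h.action_mem s t

lemma abs_sub_le (h : IsBoundedFlow J S F a b w l) (hJS : IsSplitting J S)
    (hF : Differentiable ℝ F) (hab : a < b) (s t : ℝ) :
    |l t - l s| ≤ √((b - a) * |t - s|) :=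
  norm_sub_le_sqrt_of_dissipation hab h.deriv_snd (h.hasDerivAt_action hJS hF)
    (fun t => by
      rw [Real.norm_eq_abs, sq_abs]
      nlinarith [sq_nonneg (‖l t • S (gradient F (S (w t))) - J (w t)‖)]) h.action_mem s t

/-- The smoothed trajectory is bounded. -/
lemma norm_smooth_le (h : IsBoundedFlow J S F a b w l) (hJS : IsSplitting J S)
    (hF : Differentiable ℝ F) (hab : a < b) {R δ : ℝ} (hδ : 0 < δ)
    (hR : ∀ u, |F u| ≤ δ → ‖u‖ ≤ R) (t : ℝ) :
    ‖S (w t)‖ ≤ R + ‖S‖ * √((b - a) * ((b - a + 1) / δ ^ 2)) := by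
  have hA : 0 < b - a := sub_pos.2 hab
  set T := (b - a + 1) / δ ^ 2 with hT
  have hTpos : 0 < T := by positivity
  obtain ⟨s, hs, hsF⟩ : ∃ s ∈ Set.Icc t (t + T), |F (S (w s))| ≤ δ := by
    by_contra! hcon
    have := mul_sub_le_of_hasDerivAt (fun r => (h.hasDerivAt_action hJS hF r).neg)
      (by linarith : t ≤ t + T) (κ := δ ^ 2) (fun r hr => by
        have h1 := hcon r hr
        have h2 : δ ^ 2 ≤ F (S (w r)) ^ 2 := by
          rw [← sq_abs (F _)]
          gcongr
        rw [neg_neg]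
        nlinarith [sq_nonneg (‖l r • S (gradient F (S (w r))) - J (w r)‖)])
    have h3 : δ ^ 2 * (t + T - t) = b - a + 1 := by
      rw [hT]
      field_simp
      ring
    rw [h3] at this
    simp only [Pi.neg_apply] at this
    linarith [(h.action_mem t).2, (h.action_mem (t + T)).1]
  have h1 : ‖S (w t) - S (w s)‖ ≤ ‖S‖ * √((b - a) * T) := by
    rw [← map_sub]
    refine (S.le_opNorm _).trans (mul_le_mul_of_nonneg_left ?_ (norm_nonneg _))
    refine (h.norm_sub_le hJS hF hab s t).trans (Real.sqrt_le_sqrt ?_)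
    gcongr
    rw [abs_le]
    constructor <;> linarith [hs.1, hs.2]
  calc ‖S (w t)‖ = ‖S (w s) + (S (w t) - S (w s))‖ := by congr 1; abel
    _ ≤ ‖S (w s)‖ + ‖S (w t) - S (w s)‖ := norm_add_le _ _
    _ ≤ _ := add_le_add (hR _ hsF) h1

/-- Where the multiplier is bounded, the gradient of `F` along the flow is bounded. -/
lemma exists_norm_gradient_le (hJS : IsSplitting J S) (hF : Differentiable ℝ F)
    (hgrad : Continuous (gradient F)) (hK : rfCompactMap fun u => S (S (gradient F u)))
    (hab : a < b) {R δ : ℝ} (hδ : 0 < δ) (hR : ∀ u, |F u| ≤ δ → ‖u‖ ≤ R) (Λ : ℝ) :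
    ∃ G, ∀ w l, IsBoundedFlow J S F a b w l → ∀ t, |l t| ≤ Λ → ‖gradient F (S (w t))‖ ≤ G := by
  rcases lt_or_ge Λ 0 with hΛ | hΛ
  · exact ⟨0, fun w l _ t ht => absurd (ht.trans_lt hΛ) (abs_nonneg _).not_gt⟩
  have hA : 0 < b - a := sub_pos.2 hab
  set R₁ := R + ‖S‖ * √((b - a) * ((b - a + 1) / δ ^ 2))
  set 𝒦 := (fun u => S (S (gradient F u))) '' Metric.closedBall 0 R₁
  have h𝒦 : TotallyBounded 𝒦 :=
    (hK.2 _ Metric.isBounded_closedBall).totallyBounded.subset subset_closure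
  set Pp : V →L[ℝ] V := (1 / 2 : ℝ) • (ContinuousLinearMap.id ℝ V + J) with hPp
  set Pm : V →L[ℝ] V := (1 / 2 : ℝ) • (ContinuousLinearMap.id ℝ V - J) with hPm
  have hPpJ : ∀ x, Pp (J x) = Pp x := fun x => by simp [hPp, hJS.invol, add_comm]
  have hPmJ : ∀ x, Pm (J x) = -Pm x := fun x => by
    simp [hPm, hJS.invol]
    module
  set 𝒯 : Set V := Pp '' 𝒦 ∪ Pm '' 𝒦
  have h𝒯 : TotallyBounded 𝒯 :=
    (h𝒦.image Pp.uniformContinuous).union (h𝒦.image Pm.uniformContinuous)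
  set 𝒞 : Set V := closure (absConvexHull ℝ 𝒯)
  have h𝒞 : IsCompact 𝒞 :=
    isCompact_iff_totallyBounded_isComplete.2 ⟨h𝒯.absConvexHull.closure, isClosed_closure.isComplete⟩
  have hsub : 𝒯 ⊆ 𝒞 := subset_absConvexHull.trans subset_closure
  have hconv : Convex ℝ 𝒞 := (convex_absConvexHull (s := 𝒯)).closure
  have hneg : ∀ x ∈ 𝒞, -x ∈ 𝒞 := fun x hx =>
    (balanced_absConvexHull (𝕜 := ℝ) (s := 𝒯)).closure.neg_mem_iff.2 hx
  have hne : ∀ u, ‖u‖ ≤ R₁ → Pp (S (S (gradient F u))) ∈ 𝒞 ∧ Pm (S (S (gradient F u))) ∈ 𝒞 :=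
    fun u hu =>
      have hmem : S (S (gradient F u)) ∈ 𝒦 := ⟨u, by simpa using hu, rfl⟩
      ⟨hsub (Or.inl ⟨_, hmem, rfl⟩), hsub (Or.inr ⟨_, hmem, rfl⟩)⟩
  set M := Λ + (b - a) + 1 with hM
  have hMpos : 0 < M := by positivity
  obtain ⟨G, hG⟩ := ((h𝒞.smul M).add (h𝒞.smul M)).exists_bound_of_continuousOn
    hgrad.continuousOn
  refine ⟨G, fun w l h t ht => hG _ ?_⟩
  have hbd : ∀ s, ‖S (w s)‖ ≤ R₁ := h.norm_smooth_le hJS hF hab hδ hR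
  have hzero : (0 : V) ∈ 𝒞 := by
    have h1 := (hne _ (hbd t)).1
    have := hconv h1 (hneg _ h1) (by norm_num : (0 : ℝ) ≤ 1 / 2) (by norm_num : (0 : ℝ) ≤ 1 / 2)
      (by norm_num)
    simpa using this
  have hl : ∀ s, |l s| ≤ Λ + (b - a) + 1 * |t - s| := fun s => by
    have h1 := h.abs_sub_le hJS hF hab t s
    rw [abs_sub_comm s t] at h1
    have h2 : √((b - a) * |t - s|) ≤ (b - a) + |t - s| := by
      apply Real.sqrt_le_iff.2
      constructor
      · positivity
      · nlinarith [abs_nonneg (t - s), mul_nonneg hA.le (abs_nonneg (t - s))]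
    have h3 : |l s| ≤ |l t| + |l s - l t| := by
      simpa using abs_add_le (l t) (l s - l t)
    linarith
  have hp := smul_mem_of_bounded_of_hasDerivAt (K := 𝒞) (f := fun s => Pp (S (w s)))
    (k := fun s => Pp (S (S (gradient F (S (w s)))))) (m := l) (B := ‖Pp‖ * R₁) (t := t)
    (α := Λ + (b - a)) (β := 1) hconv isClosed_closure hneg hzero (by positivity) zero_le_one
    (fun s => (Pp.le_opNorm _).trans (by gcongr; exact hbd s))
    (fun s => (Pp.hasFDerivAt.comp_hasDerivAt s (h.hasDerivAt_smooth hJS s)).congr_deriv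
      (by rw [map_sub, map_smul, hPpJ]))
    (fun s => (hne _ (hbd s)).1)
    (fun s hs => by simpa [abs_of_nonneg (sub_nonneg.2 hs)] using hl s)
  have hm := smul_mem_of_bounded_of_hasDerivAt (K := 𝒞) (f := fun s => Pm (S (w (-s))))
    (k := fun s => Pm (S (S (gradient F (S (w (-s))))))) (m := fun s => -l (-s))
    (B := ‖Pm‖ * R₁) (t := -t)
    (α := Λ + (b - a)) (β := 1) hconv isClosed_closure hneg hzero (by positivity) zero_le_one
    (fun s => (Pm.le_opNorm _).trans (by gcongr; exact hbd _))
    (fun s => ((Pm.hasFDerivAt.comp_hasDerivAt (-s) (h.hasDerivAt_smooth hJS (-s))).scomp s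
      (hasDerivAt_neg s)).congr_deriv (by
        rw [map_sub, map_smul, hPmJ]
        module))
    (fun s => (hne _ (hbd _)).2)
    (fun s hs => by
      have := hl (-s)
      rw [sub_neg_eq_add, abs_of_nonpos (a := t + s) (by linarith)] at this
      rw [abs_neg]
      linarith)
  simp only [neg_neg] at hm
  refine ⟨_, Set.smul_mem_smul_set hp, _, Set.smul_mem_smul_set hm, ?_⟩
  simp only [hM, smul_smul]
  rw [mul_inv_cancel₀ (by positivity), one_smul, one_smul]
  simp [hPp, hPm]
  module

/-- Where the multiplier is bounded, the trajectory is bounded in the strong norm. -/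
lemma exists_norm_le (hJS : IsSplitting J S) (hF : Differentiable ℝ F)
    (hgrad : Continuous (gradient F)) (hK : rfCompactMap fun u => S (S (gradient F u)))
    (hab : a < b) {R δ : ℝ} (hδ : 0 < δ) (hR : ∀ u, |F u| ≤ δ → ‖u‖ ≤ R) (Λ : ℝ) :
    ∃ C, ∀ w l, IsBoundedFlow J S F a b w l → ∀ t, |l t| ≤ Λ → ‖w t‖ ≤ C := by
  obtain ⟨G, hG⟩ := exists_norm_gradient_le (J := J) hJS hF hgrad hK hab hδ hR (Λ + √(b - a))
  refine ⟨2 * √(b - a) + (Λ + √(b - a)) * (‖S‖ * G), fun w l h t ht => ?_⟩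
  set D := √(b - a)
  have hD : 0 ≤ D := Real.sqrt_nonneg _
  have hwin : ∀ s ∈ Set.Icc (t - 1) t, √((b - a) * |s - t|) ≤ D := fun s hs => by
    apply Real.sqrt_le_sqrt
    have : |s - t| ≤ 1 := abs_le.2 ⟨by linarith [hs.1], by linarith [hs.2]⟩
    nlinarith
  have hw : ∀ s ∈ Set.Icc (t - 1) t, ‖w s - w t‖ ≤ D := fun s hs =>
    (h.norm_sub_le hJS hF hab t s).trans (hwin s hs)
  have hl : ∀ s ∈ Set.Icc (t - 1) t, |l s| ≤ Λ + D := fun s hs => by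
    have h1 := (h.abs_sub_le hJS hF hab t s).trans (hwin s hs)
    have h3 : |l s| ≤ |l t| + |l s - l t| := by
      simpa using abs_add_le (l t) (l s - l t)
    linarith
  set y := ‖w t‖ with hy
  have hf : ∀ s, HasDerivAt (fun r => -⟪J (w t), w r⟫)
      (-⟪J (w t), l s • S (gradient F (S (w s))) - J (w s)⟫) s := fun s => by
    refine (((hasDerivAt_const s (J (w t))).inner ℝ (h.deriv_fst s)).neg).congr_deriv ?_
    simp
  have key := mul_sub_le_of_hasDerivAt hf (s := t - 1) (t := t) (by linarith)
    (κ := y * (y - D - (Λ + D) * (‖S‖ * G))) (fun s hs => by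
      rw [inner_sub_right, hJS.inner_map_map, real_inner_smul_right]
      have h1 : y * y - y * D ≤ ⟪w t, w s⟫ := by
        have h2 := real_inner_le_norm (w t) (w t - w s)
        rw [inner_sub_right, real_inner_self_eq_norm_sq, norm_sub_rev] at h2
        have h3 : ‖w t‖ * ‖w s - w t‖ ≤ y * D :=
          mul_le_mul_of_nonneg_left (hw s hs) (norm_nonneg _)
        nlinarith
      have h4 : l s * ⟪J (w t), S (gradient F (S (w s)))⟫ ≤ (Λ + D) * (y * (‖S‖ * G)) := by
        refine (le_abs_self _).trans ?_
        rw [abs_mul]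
        refine mul_le_mul (hl s hs) ?_ (abs_nonneg _) ((abs_nonneg _).trans (hl s hs))
        refine (abs_real_inner_le_norm _ _).trans ?_
        rw [hJS.norm_map]
        refine mul_le_mul_of_nonneg_left ?_ (norm_nonneg _)
        exact (S.le_opNorm _).trans
          (mul_le_mul_of_nonneg_left (hG w l h s (hl s hs)) (norm_nonneg _))
      linarith)
  have h5 : -⟪J (w t), w t⟫ - -⟪J (w t), w (t - 1)⟫ ≤ y * D := by
    rw [neg_sub_neg, ← inner_sub_right]
    refine (real_inner_le_norm _ _).trans ?_
    rw [hJS.norm_map]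
    exact mul_le_mul_of_nonneg_left (hw _ ⟨le_rfl, by linarith⟩) (norm_nonneg _)
  have hy0 : 0 ≤ y := norm_nonneg _
  have hΛ : 0 ≤ Λ := (abs_nonneg _).trans ht
  have hG0 : 0 ≤ G := (norm_nonneg _).trans (hG w l h t (by linarith))
  rcases hy0.eq_or_lt with h0 | h0
  · rw [← h0]
    positivity
  · have h6 : y * (y - D - (Λ + D) * (‖S‖ * G)) ≤ y * D := by linarith
    linarith [le_of_mul_le_mul_left h6 h0]

/-- A time interval on which the multiplier is large is short, in terms of the strong norm at any
time of the interval. -/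
lemma sub_le_of_le_snd (h : IsBoundedFlow J S F a b w l) (hJS : IsSplitting J S)
    (hF : Differentiable ℝ F) (hab : a < b) {c δ : ℝ} (hδ : 0 < δ) (hδc : 4 * δ ≤ c)
    (hc : ∀ u, |F u| ≤ δ → c ≤ ⟪gradient F u, u⟫) {s t r : ℝ} (hr : r ∈ Set.Icc s t)
    (hl : ∀ x ∈ Set.Icc s t, 2 * (b - a + 2 + 2 * |b|) / c ≤ l x) {Y : ℝ} (hY : ‖w r‖ ≤ Y) :
    t - s ≤ Y ^ 2 + (b - a) * (b - a + 2) / δ ^ 2 + (b - a) * Y / δ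
      + ((b - a) * √(b - a) / δ) ^ 2 / 4 := by
  have hst : s ≤ t := hr.1.trans hr.2
  have hA : 0 < b - a := sub_pos.2 hab
  have hcpos : 0 < c := by linarith
  set A := b - a with hAdef
  set κ := A + 2 with hκ
  have hY0 : 0 ≤ Y := (norm_nonneg _).trans hY
  set N := t - s with hN
  have hN0 : 0 ≤ N := sub_nonneg.2 hst
  have hyb : ∀ x ∈ Set.Icc s t, ‖w x‖ ≤ Y + √(A * N) := fun x hx => by
    have h1 := h.norm_sub_le hJS hF hab r x
    have h2 : √((b - a) * |x - r|) ≤ √(A * N) := by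
      apply Real.sqrt_le_sqrt
      gcongr
      rw [abs_le]
      constructor <;> linarith [hx.1, hx.2, hr.1, hr.2]
    have h3 : ‖w x‖ ≤ ‖w r‖ + ‖w x - w r‖ := by
      simpa using norm_add_le (w r) (w x - w r)
    linarith
  set Z := Y + √(A * N) with hZ
  have hZ0 : 0 ≤ Z := by positivity
  set B := κ / δ ^ 2 + Z / δ with hB
  have hg : ∀ x, HasDerivAt (fun x => (1 / 2) * ⟪w x, w x⟫
      - B * ((1 / 2) * ⟪J (w x), w x⟫ - l x * F (S (w x))))
      (⟪l x • S (gradient F (S (w x))) - J (w x), w x⟫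
        + B * (‖l x • S (gradient F (S (w x))) - J (w x)‖ ^ 2 + F (S (w x)) ^ 2)) x := fun x => by
    refine ((((h.deriv_fst x).inner ℝ (h.deriv_fst x)).const_mul (1 / 2)).sub
      ((h.hasDerivAt_action hJS hF x).const_mul B)).congr_deriv ?_
    rw [real_inner_comm (l x • S (gradient F (S (w x))) - J (w x)) (w x)]
    ring
  have hκN := mul_sub_le_of_hasDerivAt hg hst (κ := κ) (fun x hx => by
    set v := l x • S (gradient F (S (w x))) - J (w x) with hv
    have hB0 : 0 ≤ B := by positivity
    rcases le_or_gt |F (S (w x))| δ with hFx | hFx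
    · have h1 := hc _ hFx
      have h2 := hl x hx
      rw [div_le_iff₀ hcpos] at h2
      have hl0 : 0 ≤ l x := by
        refine le_trans ?_ (hl x hx)
        positivity
      have h3 : ⟪v, w x⟫ = l x * ⟪gradient F (S (w x)), S (w x)⟫ - ⟪J (w x), w x⟫ := by
        rw [hv, inner_sub_left, real_inner_smul_left, hJS.smooth_symm]
      have h4 := (h.action_mem x).2
      have h5 : 0 ≤ B * (‖v‖ ^ 2 + F (S (w x)) ^ 2) := by positivity
      have h6 : l x * F (S (w x)) ≤ l x * (c / 4) :=
        mul_le_mul_of_nonneg_left (by linarith [le_abs_self (F (S (w x)))]) hl0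
      have h7 : l x * c ≤ l x * ⟪gradient F (S (w x)), S (w x)⟫ :=
        mul_le_mul_of_nonneg_left h1 hl0
      linarith [le_abs_self b]
    · have h1 : -(‖v‖ * Z) ≤ ⟪v, w x⟫ := by
        have h2 := neg_le_of_abs_le (abs_real_inner_le_norm v (w x))
        have h3 := mul_le_mul_of_nonneg_left (hyb x hx) (norm_nonneg v)
        linarith
      have h2 : δ ^ 2 ≤ F (S (w x)) ^ 2 := by
        rw [← sq_abs (F _)]
        gcongr
      have h3 : ‖v‖ * δ ≤ ‖v‖ ^ 2 + F (S (w x)) ^ 2 := by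
        nlinarith [sq_nonneg (‖v‖ - δ), norm_nonneg v]
      have h4 : κ / δ ^ 2 * δ ^ 2 ≤ κ / δ ^ 2 * (‖v‖ ^ 2 + F (S (w x)) ^ 2) := by
        gcongr
        nlinarith [sq_nonneg ‖v‖]
      have h5 : Z / δ * (‖v‖ * δ) ≤ Z / δ * (‖v‖ ^ 2 + F (S (w x)) ^ 2) := by
        gcongr
      have h6 : κ / δ ^ 2 * δ ^ 2 = κ := by field_simp
      have h7 : Z / δ * (‖v‖ * δ) = ‖v‖ * Z := by field_simp
      rw [hB, add_mul]
      linarith)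
  have hB0 : 0 ≤ B := by positivity
  have h1 : ⟪w t, w t⟫ ≤ Z ^ 2 := by
    rw [real_inner_self_eq_norm_sq]
    have := hyb t (Set.right_mem_Icc.2 hst)
    gcongr
  have h2 : (0 : ℝ) ≤ ⟪w s, w s⟫ := real_inner_self_nonneg
  have h3 : B * ((1 / 2) * ⟪J (w s), w s⟫ - l s * F (S (w s))
      - ((1 / 2) * ⟪J (w t), w t⟫ - l t * F (S (w t)))) ≤ B * A :=
    mul_le_mul_of_nonneg_left (by linarith [(h.action_mem s).2, (h.action_mem t).1]) hB0
  have h4 : Z ^ 2 ≤ 2 * Y ^ 2 + 2 * (A * N) := by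
    have := Real.sq_sqrt (mul_nonneg hA.le hN0)
    rw [hZ]
    nlinarith [sq_nonneg (Y - √(A * N))]
  have h5 : B * A = A * κ / δ ^ 2 + A * Y / δ + A * √A / δ * √N := by
    rw [hB, hZ, Real.sqrt_mul hA.le]
    ring
  have h6 : A * √A / δ * √N ≤ (A * √A / δ) ^ 2 / 4 + N := by
    nlinarith [sq_nonneg (A * √A / δ / 2 - √N), Real.sq_sqrt hN0]
  have h7 : κ * N = A * N + 2 * N := by
    rw [hκ]
    ring
  linarith

/-- The multiplier is bounded above. -/
lemma exists_snd_le (hJS : IsSplitting J S) (hF : Differentiable ℝ F)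
    (hgrad : Continuous (gradient F)) (hK : rfCompactMap fun u => S (S (gradient F u)))
    (hab : a < b) {R c δ : ℝ} (hδ : 0 < δ) (hδc : 4 * δ ≤ c) (hR : ∀ u, |F u| ≤ δ → ‖u‖ ≤ R)
    (hc : ∀ u, |F u| ≤ δ → c ≤ ⟪gradient F u, u⟫) :
    ∃ Λ, ∀ w l, IsBoundedFlow J S F a b w l → ∀ t, l t ≤ Λ := by
  have hA : 0 < b - a := sub_pos.2 hab
  set L := 2 * (b - a + 2 + 2 * |b|) / c with hL
  have hL0 : 0 ≤ L := by
    have : 0 < c := by linarith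
    positivity
  obtain ⟨Y, hY⟩ := exists_norm_le hJS hF hgrad hK hab hδ hR L
  set D : ℝ → ℝ := fun Y => Y ^ 2 + (b - a) * (b - a + 2) / δ ^ 2 + (b - a) * Y / δ
      + ((b - a) * √(b - a) / δ) ^ 2 / 4 with hD
  refine ⟨L + √((b - a) * D Y), fun w l h t => ?_⟩
  rcases le_or_gt (l t) L with hlt | hlt
  · linarith [Real.sqrt_nonneg ((b - a) * D Y)]
  have hcont : Continuous l := continuous_iff_continuousAt.2 fun s => (h.deriv_snd s).continuousAt
  obtain ⟨s, hst, hs⟩ : ∃ s ≤ t, l s ≤ L := by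
    by_contra! hcon
    have hD0 : 0 ≤ D ‖w t‖ := by positivity
    have : t - (t - (D ‖w t‖ + 1)) ≤ D ‖w t‖ :=
      h.sub_le_of_le_snd hJS hF hab hδ hδc hc (r := t)
      ⟨by linarith, le_rfl⟩ (fun x hx => (hcon x hx.2).le) le_rfl
    linarith
  obtain ⟨r, ⟨hr, hrL⟩, hrmax⟩ : ∃ r, IsGreatest {x ∈ Set.Icc s t | l x = L} r := by
    refine IsCompact.exists_isGreatest
      (isCompact_Icc.inter_right (isClosed_eq hcont continuous_const)) ?_
    obtain ⟨x, hx, hxL⟩ := intermediate_value_Icc hst hcont.continuousOn ⟨hs, hlt.le⟩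
    exact ⟨x, hx, hxL⟩
  have hge : ∀ x ∈ Set.Icc r t, L ≤ l x := fun x hx => by
    by_contra! hxL
    obtain ⟨y, hy, hyL⟩ := intermediate_value_Icc hx.2 hcont.continuousOn ⟨hxL.le, hlt.le⟩
    have hyr : y ≤ r := hrmax ⟨⟨hr.1.trans (hx.1.trans hy.1), hy.2⟩, hyL⟩
    have : x = r := le_antisymm (hy.1.trans hyr) hx.1
    rw [this, hrL] at hxL
    exact lt_irrefl _ hxL
  have h1 := h.sub_le_of_le_snd hJS hF hab hδ hδc hc (Set.left_mem_Icc.2 hr.2) hge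
    (hY w l h r (by rw [hrL, abs_of_nonneg hL0]))
  have h2 := (le_abs_self _).trans (h.abs_sub_le hJS hF hab r t)
  rw [abs_of_nonneg (sub_nonneg.2 hr.2)] at h2
  have h3 : √((b - a) * (t - r)) ≤ √((b - a) * D Y) :=
    Real.sqrt_le_sqrt (mul_le_mul_of_nonneg_left h1 hA.le)
  linarith

/-- Uniform bounds for flow lines of bounded action. -/
theorem exists_uniform_bound (hJS : IsSplitting J S) (hF : ContDiff ℝ 1 F)
    (hK : rfCompactMap fun u => S (S (gradient F u))) (hF2 : rfF2 F) (hab : a < b) :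
    ∃ C, 0 < C ∧ ∀ w l, IsBoundedFlow J S F a b w l → ∀ t, |l t| ≤ C ∧ ‖w t‖ ≤ C := by
  obtain ⟨R, c, ε, -, hc0, hε, h⟩ := hF2
  have hFd : Differentiable ℝ F := hF.differentiable one_ne_zero
  have hgrad : Continuous (gradient F) :=
    (InnerProductSpace.toDual ℝ V).symm.continuous.comp (hF.continuous_fderiv one_ne_zero)
  obtain ⟨δ, hδ, hδε, hδc⟩ : ∃ δ > 0, δ ≤ ε ∧ 4 * δ ≤ c :=
    ⟨min ε (c / 4), by positivity, min_le_left _ _, by linarith [min_le_right ε (c / 4)]⟩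
  have hR : ∀ u, |F u| ≤ δ → ‖u‖ ≤ R := fun u hu => (h u (hu.trans hδε)).1
  have hc : ∀ u, |F u| ≤ δ → c ≤ ⟪gradient F u, u⟫ := fun u hu => (h u (hu.trans hδε)).2
  obtain ⟨Λ₁, h₁⟩ := exists_snd_le hJS hFd hgrad hK hab hδ hδc hR hc
  obtain ⟨Λ₂, h₂⟩ := exists_snd_le hJS.neg hFd hgrad hK (neg_lt_neg hab) hδ hδc hR hc
  obtain ⟨Y, hY⟩ := exists_norm_le hJS hFd hgrad hK hab hδ hR (max Λ₁ Λ₂)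
  refine ⟨max 1 (max (max Λ₁ Λ₂) Y), by positivity, fun w l hw t => ?_⟩
  have hl : |l t| ≤ max Λ₁ Λ₂ := by
    have := h₂ _ _ hw.reverse (-t)
    rw [neg_neg] at this
    exact abs_le.2 ⟨by linarith [le_max_right Λ₁ Λ₂], (h₁ w l hw t).trans (le_max_left _ _)⟩
  exact ⟨hl.trans ((le_max_left _ _).trans (le_max_right _ _)),
    (hY w l hw t hl).trans ((le_max_right _ _).trans (le_max_right _ _))⟩

end IsBoundedFlow

end AbstractFlow

section Coordinates

set_option linter.unusedSectionVars false

lemma summable_sq_iff_memℓp {c : Idx → ℝ} : Summable (fun i => c i ^ 2) ↔ Memℓp c 2 := by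
  rw [memℓp_gen_iff (by norm_num)]
  simp

/-- The vector with prescribed square-summable coordinates. -/
def ofCoords (b : HilbertBasis Idx ℝ E) (c : Idx → ℝ) (hc : Summable fun i => c i ^ 2) : E :=
  b.repr.symm ⟨c, summable_sq_iff_memℓp.1 hc⟩

lemma rfCoord_ofCoords (b : HilbertBasis Idx ℝ E) {c : Idx → ℝ}
    (hc : Summable fun i => c i ^ 2) (i : Idx) : rfCoord b (ofCoords b c hc) i = c i := by
  simp [rfCoord, ofCoords]

lemma ext_rfCoord (b : HilbertBasis Idx ℝ E) {x y : E} (h : ∀ i, rfCoord b x i = rfCoord b y i) :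
    x = y :=
  b.repr.injective (lp.ext (funext h))

lemma rfCoord_add (b : HilbertBasis Idx ℝ E) (x y : E) (i : Idx) :
    rfCoord b (x + y) i = rfCoord b x i + rfCoord b y i := by
  simp [rfCoord]

lemma rfCoord_sub (b : HilbertBasis Idx ℝ E) (x y : E) (i : Idx) :
    rfCoord b (x - y) i = rfCoord b x i - rfCoord b y i := by
  simp [rfCoord]

lemma rfCoord_smul (b : HilbertBasis Idx ℝ E) (r : ℝ) (x : E) (i : Idx) :
    rfCoord b (r • x) i = r * rfCoord b x i := by
  simp [rfCoord]

lemma inner_eq_tsum_rfCoord (b : HilbertBasis Idx ℝ E) (x y : E) :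
    ⟪x, y⟫ = ∑' i, rfCoord b x i * rfCoord b y i := by
  rw [← b.repr.inner_map_map, lp.inner_eq_tsum]
  exact tsum_congr fun i => mul_comm _ _

lemma summable_rfCoord_sq (b : HilbertBasis Idx ℝ E) (x : E) :
    Summable fun i => rfCoord b x i ^ 2 :=
  summable_sq_iff_memℓp.2 (b.repr x).2

lemma norm_eq_sqrt_tsum_rfCoord (b : HilbertBasis Idx ℝ E) (x : E) :
    ‖x‖ = √(∑' i, rfCoord b x i ^ 2) := by
  rw [norm_eq_sqrt_real_inner, inner_eq_tsum_rfCoord b]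
  simp only [sq]

lemma summable_mul_rfCoord_sq (b : HilbertBasis Idx ℝ E) {c : Idx → ℝ} {M : ℝ}
    (hc : ∀ i, |c i| ≤ M) (x : E) : Summable fun i => (c i * rfCoord b x i) ^ 2 := by
  refine Summable.of_nonneg_of_le (fun i => sq_nonneg _) (fun i => ?_)
    ((summable_rfCoord_sq b x).mul_left (M ^ 2))
  rw [mul_pow, ← sq_abs (c i)]
  gcongr
  exact hc i

/-- Bounded diagonal operators. -/
lemma exists_diagonal (b : HilbertBasis Idx ℝ E) {c : Idx → ℝ} {M : ℝ} (hc : ∀ i, |c i| ≤ M) :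
    ∃ T : E →L[ℝ] E, ∀ x i, rfCoord b (T x) i = c i * rfCoord b x i := by
  have hM : 0 ≤ M := (abs_nonneg _).trans (hc ⟨1, one_ne_zero⟩)
  refine ⟨LinearMap.mkContinuous
    { toFun := fun x => ofCoords b _ (summable_mul_rfCoord_sq b hc x)
      map_add' := fun x y => ext_rfCoord b fun i => by
        simp only [rfCoord_ofCoords, rfCoord_add]
        ring
      map_smul' := fun r x => ext_rfCoord b fun i => by
        simp only [rfCoord_ofCoords, rfCoord_smul, RingHom.id_apply]
        ring } M (fun x => ?_), fun x i =>
      rfCoord_ofCoords b (summable_mul_rfCoord_sq b hc x) i⟩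
  simp only [LinearMap.coe_mk, AddHom.coe_mk]
  rw [norm_eq_sqrt_tsum_rfCoord b, norm_eq_sqrt_tsum_rfCoord b x]
  refine Real.sqrt_le_iff.2 ⟨by positivity, ?_⟩
  rw [mul_pow, Real.sq_sqrt (tsum_nonneg fun i => sq_nonneg _), ← tsum_mul_left]
  simp only [rfCoord_ofCoords]
  refine (summable_mul_rfCoord_sq b hc x).tsum_le_tsum (fun i => ?_)
    ((summable_rfCoord_sq b x).mul_left (M ^ 2))
  rw [mul_pow, ← sq_abs (c i)]
  gcongr
  exact hc i

lemma rfCoord_tsum_smul (b : HilbertBasis Idx ℝ E) {c : Idx → ℝ}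
    (hc : Summable fun i => c i ^ 2) (i : Idx) : rfCoord b (∑' j, c j • (b j : E)) i = c i := by
  have := (b.hasSum_repr_symm ⟨c, summable_sq_iff_memℓp.1 hc⟩).tsum_eq
  simp only at this
  rw [this]
  exact rfCoord_ofCoords b hc i

lemma rfCoord_rfPos (b : HilbertBasis Idx ℝ E) (u : E) (i : Idx) :
    rfCoord b (rfPos b u) i = if 0 < (i : ℤ) then rfCoord b u i else 0 :=
  rfCoord_tsum_smul b (Summable.of_nonneg_of_le (fun _ => sq_nonneg _)
    (fun j => by split_ifs <;> simp [sq_nonneg]) (summable_rfCoord_sq b u)) i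

lemma rfCoord_rfNeg (b : HilbertBasis Idx ℝ E) (u : E) (i : Idx) :
    rfCoord b (rfNeg b u) i = if (i : ℤ) < 0 then rfCoord b u i else 0 :=
  rfCoord_tsum_smul b (Summable.of_nonneg_of_le (fun _ => sq_nonneg _)
    (fun j => by split_ifs <;> simp [sq_nonneg]) (summable_rfCoord_sq b u)) i

lemma rfNormH_eq_norm (b : HilbertBasis Idx ℝ E) {lam : Idx → ℝ} {x y : E}
    (h : ∀ i, rfCoord b x i = √|lam i| * rfCoord b y i) : rfNormH b lam y = ‖x‖ := by
  rw [rfNormH, norm_eq_sqrt_tsum_rfCoord b]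
  congr 2
  funext i
  rw [h, mul_pow, Real.sq_sqrt (abs_nonneg _)]

lemma rfLam.exists_inv_sqrt_le {lam : Idx → ℝ} (h : rfLam lam) :
    ∃ M, ∀ i, |(√|lam i|)⁻¹| ≤ M := by
  have h1 : Tendsto (fun i => |(√|lam i|)⁻¹|) cofinite (𝓝 0) := by
    simpa using (tendsto_inv_atTop_zero.comp (Real.tendsto_sqrt_atTop.comp h.2.2)).abs
  obtain ⟨M, hM⟩ := h1.bddAbove_range_of_cofinite
  exact ⟨M, fun i => hM ⟨i, rfl⟩⟩

/-- The flow in the `H`-norm is conjugate to a flow in `E` through `|L|^{1/2}`. -/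
lemma exists_splitting_isBoundedFlow (b : HilbertBasis Idx ℝ E) {lam : Idx → ℝ}
    (hlam : rfLam lam) (F : E → ℝ) (aa bb : ℝ) :
    ∃ J S : E →L[ℝ] E, IsSplitting J S ∧
      (∀ u, S (S (gradient F u)) = rfAbsLinv b lam (gradient F u)) ∧
      ∀ (u : ℝ → E) (l : ℝ → ℝ), (∀ t, rfMemH b lam (u t)) →
        (∀ t, rfHasHDerivAt b lam u (rfFlowVec b lam F (u t) (l t)) t) →
        (∀ t, HasDerivAt l (F (u t)) t) →
        (∀ t, aa ≤ rfI b lam F (u t) (l t) ∧ rfI b lam F (u t) (l t) ≤ bb) →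
        ∃ w, IsBoundedFlow J S F aa bb w l ∧ ∀ t, rfNormH b lam (u t) = ‖w t‖ := by
  obtain ⟨M, hM⟩ := hlam.exists_inv_sqrt_le
  obtain ⟨S, hS⟩ := exists_diagonal b hM
  obtain ⟨J, hJ⟩ := exists_diagonal b (c := fun i => if 0 < (i : ℤ) then 1 else -1) (M := 1)
    (fun i => by split_ifs <;> simp)
  have hpos : ∀ i, 0 < √|lam i| := fun i => Real.sqrt_pos.2 (abs_pos.2 (hlam.1 i))
  have hSS : ∀ v, S (S v) = rfAbsLinv b lam v := fun v => by
    have hcoord : ∀ i, rfCoord b (S (S v)) i = |lam i|⁻¹ * rfCoord b v i := fun i => by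
      rw [hS, hS, ← mul_assoc, ← mul_inv, Real.mul_self_sqrt (abs_nonneg _)]
    refine ext_rfCoord b fun i => ?_
    have hsum := summable_rfCoord_sq b (S (S v))
    simp only [hcoord] at hsum
    rw [hcoord, rfAbsLinv, rfCoord_tsum_smul b hsum]
  have hJS : IsSplitting J S :=
    { symm := fun x y => by
        rw [inner_eq_tsum_rfCoord b, inner_eq_tsum_rfCoord b]
        refine tsum_congr fun i => ?_
        rw [hJ, hJ]
        ring
      invol := fun x => ext_rfCoord b fun i => by
        rw [hJ, hJ]
        split_ifs <;> ring
      smooth_symm := fun x y => by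
        rw [inner_eq_tsum_rfCoord b, inner_eq_tsum_rfCoord b]
        refine tsum_congr fun i => ?_
        rw [hS, hS]
        ring
      comm := fun x => ext_rfCoord b fun i => by
        rw [hS, hJ, hJ, hS]
        ring }
  refine ⟨J, S, hJS, fun u => hSS _, fun u l hmem hderiv hl hI => ?_⟩
  have hsum : ∀ t, Summable fun i => (√|lam i| * rfCoord b (u t) i) ^ 2 := fun t => by
    have h := hmem t
    unfold rfMemH at h
    simpa only [mul_pow, Real.sq_sqrt (abs_nonneg _)] using h
  set w : ℝ → E := fun t => ofCoords b _ (hsum t)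
  have hw : ∀ t i, rfCoord b (w t) i = √|lam i| * rfCoord b (u t) i := fun t i =>
    rfCoord_ofCoords b (hsum t) i
  have hSw : ∀ t, S (w t) = u t := fun t => ext_rfCoord b fun i => by
    rw [hS, hw, inv_mul_cancel_left₀ (hpos i).ne']
  have hflow : ∀ t i, rfCoord b (l t • S (gradient F (u t)) - J (w t)) i
      = √|lam i| * rfCoord b (rfFlowVec b lam F (u t) (l t)) i := fun t i => by
    rw [rfFlowVec, ← hSS]
    simp only [rfCoord_add, rfCoord_sub, rfCoord_smul, rfCoord_rfPos, rfCoord_rfNeg, hS, hJ, hw]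
    have h0 : √|lam i| * (l t * ((√|lam i|)⁻¹ * ((√|lam i|)⁻¹ * rfCoord b (gradient F (u t)) i)))
        = l t * ((√|lam i|)⁻¹ * rfCoord b (gradient F (u t)) i) := by
      have := (hpos i).ne'
      field_simp
    rcases lt_or_gt_of_ne i.2 with hi | hi
    · rw [if_neg hi.not_gt, if_pos hi, if_neg hi.not_gt, mul_add, h0]
      ring
    · rw [if_pos hi, if_neg hi.not_gt, if_pos hi, mul_add, h0]
      ring
  refine ⟨w, ⟨fun t => ?_, fun t => ?_, fun t => ?_⟩, fun t => rfNormH_eq_norm b (hw t)⟩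
  · rw [hSw, hasDerivAt_iff_tendsto_slope_zero, tendsto_iff_norm_sub_tendsto_zero]
    refine (hderiv t).congr' ?_
    filter_upwards [self_mem_nhdsWithin] with h hh
    have hh0 : h ≠ 0 := hh
    rw [rfNormH_eq_norm (x := w (t + h) - w t - h • (l t • S (gradient F (u t)) - J (w t))) b
      fun i => ?_]
    · rw [div_eq_inv_mul, ← Real.norm_eq_abs, ← norm_inv, ← norm_smul, smul_sub _ _ (h • _),
        inv_smul_smul₀ hh0]
    · rw [rfCoord_sub, rfCoord_sub, rfCoord_smul, hflow, hw, hw, rfCoord_sub, rfCoord_sub,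
        rfCoord_smul]
      ring
  · rw [hSw]
    exact hl t
  · have hL : ⟪J (w t), w t⟫ = rfLquad b lam (u t) := by
      rw [inner_eq_tsum_rfCoord b, rfLquad]
      refine tsum_congr fun i => ?_
      have h1 : (if 0 < (i : ℤ) then (1 : ℝ) else -1) * |lam i| = lam i := by
        split_ifs with hi
        · rw [abs_of_pos ((hlam.2.1 i).2 hi), one_mul]
        · rw [abs_of_nonpos (not_lt.1 fun h => hi ((hlam.2.1 i).1 h)), neg_one_mul, neg_neg]
      rw [hJ, hw]
      conv_rhs => rw [← h1, ← Real.mul_self_sqrt (abs_nonneg (lam i))]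
      ring
    rw [hSw, hL]
    exact hI t

end Coordinates

/-- Let `a < b` and let `z = (u,λ) : ℝ → H × ℝ` be a `C¹` solution of
the negative gradient flow `z' = −∇I(z)`, i.e.
`u' = u⁻ − u⁺ + λ|L|⁻¹∇F(u)` (derivative in the `H` norm, with the derivative
continuous in the `H` norm) and `λ' = F(u)`, with `a ≤ I(z(t)) ≤ b` for all `t`.
Then there is a constant `C`, depending only on `a`, `b`, `E`, `L`, `F` (and not on
`z`), with `|λ(t)| ≤ C` and `‖u(t)‖_H ≤ C` for all `t`. -/
theorem stmt6 {E : Type*} [NormedAddCommGroup E] [InnerProductSpace ℝ E] [CompleteSpace E]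
    (b : HilbertBasis Idx ℝ E) (lam : Idx → ℝ) (hlam : rfLam lam)
    (F : E → ℝ) (hF : ContDiff ℝ 2 F) (hF1 : rfF1 b lam F) (hF2 : rfF2 F)
    (aa bb : ℝ) (hab : aa < bb) :
    ∃ C : ℝ, 0 < C ∧
      ∀ (u : ℝ → E) (l : ℝ → ℝ),
        (∀ t, rfMemH b lam (u t)) →
        (∀ t, rfHasHDerivAt b lam u (rfFlowVec b lam F (u t) (l t)) t) →
        (∀ t : ℝ, Tendsto (fun s =>
            rfNormH b lam (rfFlowVec b lam F (u s) (l s) - rfFlowVec b lam F (u t) (l t)))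
          (𝓝 t) (𝓝 0)) →
        (∀ t, HasDerivAt l (F (u t)) t) →
        (∀ t, aa ≤ rfI b lam F (u t) (l t) ∧ rfI b lam F (u t) (l t) ≤ bb) →
        ∀ t : ℝ, |l t| ≤ C ∧ rfNormH b lam (u t) ≤ C := by
  obtain ⟨J, S, hJS, hSS, hflow⟩ := exists_splitting_isBoundedFlow b hlam F aa bb
  have hK : rfCompactMap fun u => S (S (gradient F u)) := by
    rw [funext hSS]
    exact hF1
  obtain ⟨C, hC, h⟩ := IsBoundedFlow.exists_uniform_bound hJS (hF.of_le one_le_two) hK hF2 hab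
  refine ⟨C, hC, fun u l hmem hderiv _ hl hI t => ?_⟩
  obtain ⟨w, hw, hnorm⟩ := hflow u l hmem hderiv hl hI
  rw [hnorm]
  exact h w l hw t
end
end

section
/- Let (u,λ) ∈ H × ℝ be a critical point of I (i.e. ∇I(u,λ) = 0), and suppose there are constants 0 < c₁ ≤ c₂ with c₁ ≤ ⟨∇F(u),u⟩ ≤ c₂. Then 2I(u,λ) = λ⟨∇F(u),u⟩, and consequently 2|I(u,λ)|/c₂ ≤ |λ| ≤ 2|I(u,λ)|/c₁. -/
noncomputable section

open scoped RealInnerProductSpace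
open Filter Topology Bornology MeasureTheory

variable {E : Type*} [NormedAddCommGroup E] [InnerProductSpace ℝ E] [CompleteSpace E]

/-- Coordinates of the image of `w` under a diagonal multiplier that is eventually at most `1`. -/
lemma rfCoord_tsum_mul (b : HilbertBasis Idx ℝ E) (w : E) (m : Idx → ℝ)
    (hm : ∀ᶠ i in cofinite, |m i| ≤ 1) (i : Idx) :
    rfCoord b (∑' j : Idx, (m j * rfCoord b w j) • (b j : E)) i = m i * rfCoord b w i := by
  have hw : Summable fun j : Idx => (rfCoord b w j) ^ 2 := by
    refine (b.summable_inner_mul_inner w w).congr fun j => ?_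
    rw [rfCoord, b.repr_apply_apply, real_inner_comm, sq]
  have hmem : Memℓp (fun j : Idx => m j * rfCoord b w j) 2 := by
    refine memℓp_gen (hw.of_norm_bounded_eventually ?_)
    filter_upwards [hm] with j hj
    simp only [ENNReal.toReal_ofNat, Real.rpow_ofNat, Real.norm_eq_abs, abs_mul, abs_pow, sq_abs, mul_pow]
    exact mul_le_of_le_one_left (sq_nonneg _) ((sq_le_one_iff_abs_le_one _).2 hj)
  have hsum := b.hasSum_repr_symm ⟨_, hmem⟩
  rw [rfCoord, hsum.tsum_eq, LinearIsometryEquiv.apply_symm_apply]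

lemma rfCoord_rfAbsLinv (b : HilbertBasis Idx ℝ E) {lam : Idx → ℝ} (hlam : rfLam lam) (w : E)
    (i : Idx) : rfCoord b (rfAbsLinv b lam w) i = |lam i|⁻¹ * rfCoord b w i := by
  refine rfCoord_tsum_mul b w (fun j => |lam j|⁻¹) ?_ i
  filter_upwards [hlam.2.2.eventually_ge_atTop 1] with j hj
  rw [abs_inv, abs_abs]
  exact inv_le_one_of_one_le₀ hj

/-- The Euler–Lagrange equation `Lu = λ∇F(u)` in coordinates. -/
lemma mul_rfCoord_of_rfGrad1_eq_zero (b : HilbertBasis Idx ℝ E) {lam : Idx → ℝ}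
    (hlam : rfLam lam) {F : E → ℝ} {u : E} {l : ℝ} (h : rfGrad1 b lam F u l = 0) (i : Idx) :
    lam i * rfCoord b u i = l * rfCoord b (gradient F u) i := by
  have hi : rfCoord b (rfPos b u) i - rfCoord b (rfNeg b u) i
      - l * rfCoord b (rfAbsLinv b lam (gradient F u)) i = 0 := by
    have := congrArg (fun x => rfCoord b x i) h
    simp only [rfGrad1, rfCoord, map_sub, map_smul, map_zero] at this
    exact this
  rw [rfCoord_rfPos, rfCoord_rfNeg, rfCoord_rfAbsLinv b hlam] at hi
  have hne := hlam.1 i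
  rcases lt_or_gt_of_ne i.2 with hneg | hpos
  · have hl : lam i < 0 := lt_of_le_of_ne
      (not_lt.1 fun hl => hneg.not_gt ((hlam.2.1 i).1 hl)) hne
    rw [if_neg hneg.not_gt, if_pos hneg, abs_of_neg hl] at hi
    field_simp at hi
    linarith
  · rw [if_pos hpos, if_neg hpos.not_gt, abs_of_pos ((hlam.2.1 i).2 hpos)] at hi
    field_simp at hi
    linarith

lemma rfLquad_of_rfGrad1_eq_zero (b : HilbertBasis Idx ℝ E) {lam : Idx → ℝ}
    (hlam : rfLam lam) {F : E → ℝ} {u : E} {l : ℝ} (h : rfGrad1 b lam F u l = 0) :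
    rfLquad b lam u = l * ⟪gradient F u, u⟫ := by
  rw [rfLquad, ← b.tsum_inner_mul_inner, ← tsum_mul_left]
  refine tsum_congr fun i => ?_
  rw [sq, ← mul_assoc, mul_rfCoord_of_rfGrad1_eq_zero b hlam h, mul_assoc, rfCoord, rfCoord,
    b.repr_apply_apply, b.repr_apply_apply, real_inner_comm]

/-- If `(u,λ)` is a critical point of `I` and
`0 < c₁ ≤ ⟨∇F(u),u⟩ ≤ c₂`, then `2I(u,λ) = λ⟨∇F(u),u⟩` and
`2|I(u,λ)|/c₂ ≤ |λ| ≤ 2|I(u,λ)|/c₁`. -/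
theorem stmt10 {E : Type*} [NormedAddCommGroup E] [InnerProductSpace ℝ E] [CompleteSpace E]
    (b : HilbertBasis Idx ℝ E) (lam : Idx → ℝ) (hlam : rfLam lam)
    (F : E → ℝ) (hF : ContDiff ℝ 2 F)
    (u : E) (l : ℝ) (hu : rfMemH b lam u)
    (hcrit1 : rfGrad1 b lam F u l = 0) (hcrit2 : F u = 0)
    (c₁ c₂ : ℝ) (hc₁ : 0 < c₁) (hc₁₂ : c₁ ≤ c₂)
    (hlow : c₁ ≤ ⟪gradient F u, u⟫) (hhigh : ⟪gradient F u, u⟫ ≤ c₂) :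
    2 * rfI b lam F u l = l * ⟪gradient F u, u⟫ ∧
      2 * |rfI b lam F u l| / c₂ ≤ |l| ∧ |l| ≤ 2 * |rfI b lam F u l| / c₁ := by
  have hI : 2 * rfI b lam F u l = l * ⟪gradient F u, u⟫ := by
    rw [rfI, hcrit2, rfLquad_of_rfGrad1_eq_zero b hlam hcrit1]
    ring
  have habs : 2 * |rfI b lam F u l| = |l| * ⟪gradient F u, u⟫ := by
    rw [← abs_of_pos (hc₁.trans_le hlow), ← abs_mul, ← hI, abs_mul, abs_two]
  refine ⟨hI, ?_, ?_⟩
  · rw [div_le_iff₀ (hc₁.trans_le hc₁₂), habs]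
    gcongr
  · rw [le_div_iff₀ hc₁, habs]
    gcongr
end
end

section
/- Let (Ω,μ) be a measure space, let p > 1, let u be a real-valued function in L^{p+1}(μ), let N be a closed linear subspace of L^{p+1}(μ), and suppose v₀ ∈ N minimizes the functional v ↦ ∫_Ω |u+v|^{p+1} dμ over N. Then ∫_Ω |u+v₀|^{p−1}(u+v₀) u dμ = ∫_Ω |u+v₀|^{p+1} dμ; in particular this quantity is nonnegative, and it is positive whenever u + v₀ is not μ-almost everywhere zero. -/
noncomputable section

open MeasureTheory

theorem integrable_abs_rpow {Ω : Type*} [MeasurableSpace Ω] {μ : Measure Ω} {q : ℝ} (hq : 0 < q)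
    {f : Ω → ℝ} (hf : MemLp f (ENNReal.ofReal q) μ) : Integrable (fun x ↦ |f x| ^ q) μ := by
  simpa [ENNReal.toReal_ofReal hq.le] using
    hf.integrable_norm_rpow (by simpa using hq) ENNReal.ofReal_ne_top

/-- The directional derivative of `f ↦ ∫ |f|^q` on `L^q`, together with the integrability of its
integrand. -/
theorem hasDerivAt_integral_abs_add_mul_rpow {Ω : Type*} [MeasurableSpace Ω] {μ : Measure Ω}
    {q : ℝ} (hq : 1 < q) {f g : Ω → ℝ} (hf : MemLp f (ENNReal.ofReal q) μ)
    (hg : MemLp g (ENNReal.ofReal q) μ) :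
    Integrable (fun x ↦ q * |f x| ^ (q - 2) * f x * g x) μ ∧
      HasDerivAt (fun t : ℝ ↦ ∫ x, |f x + t * g x| ^ q ∂μ)
        (∫ x, q * |f x| ^ (q - 2) * f x * g x ∂μ) 0 := by
  have hq₀ : 0 < q := by linarith
  have hpath (t : ℝ) : MemLp (fun x ↦ f x + t * g x) (ENNReal.ofReal q) μ :=
    hf.add (hg.const_mul t)
  have hsum : MemLp (fun x ↦ |f x| + |g x|) (ENNReal.ofReal q) μ := hf.abs.add hg.abs
  have hmeas : AEStronglyMeasurable (fun x ↦ q * |f x| ^ (q - 2) * f x * g x) μ := by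
    have h₁ := hf.aestronglyMeasurable.aemeasurable
    have h₂ := hg.aestronglyMeasurable.aemeasurable
    have h₃ : AEMeasurable (fun x ↦ |f x|) μ := h₁.norm
    exact ((((h₃.pow_const (q - 2)).const_mul q).mul h₁).mul h₂).aestronglyMeasurable
  have key := hasDerivAt_integral_of_dominated_loc_of_deriv_le (μ := μ) (𝕜 := ℝ) (x₀ := (0 : ℝ))
    (F := fun t x ↦ |f x + t * g x| ^ q)
    (F' := fun t x ↦ q * |f x + t * g x| ^ (q - 2) * (f x + t * g x) * g x)
    (bound := fun x ↦ q * |(|f x| + |g x|)| ^ q)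
    (Metric.ball_mem_nhds 0 one_pos)
    (.of_forall fun t ↦ (integrable_abs_rpow hq₀ (hpath t)).aestronglyMeasurable)
    (integrable_abs_rpow hq₀ (hpath 0)) (by simpa using hmeas) (.of_forall fun x t ht ↦ ?_)
    ((integrable_abs_rpow hq₀ hsum).const_mul q) (.of_forall fun x t _ ↦ ?_)
  · simpa using key
  · have ht' : |t| ≤ 1 := by simpa using (mem_ball_zero_iff.1 ht).le
    set m := |f x| + |g x|
    have hm : 0 ≤ m := by positivity
    have hy : |f x + t * g x| ≤ m := by
      refine (abs_add_le _ _).trans (add_le_add le_rfl ?_)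
      rw [abs_mul]
      exact mul_le_of_le_one_left (abs_nonneg _) ht'
    have hg' : |g x| ≤ m := le_add_of_nonneg_left (abs_nonneg _)
    have hpow (a : ℝ) (ha : 0 ≤ a) : a ^ (q - 2) * a = a ^ (q - 1) := by
      rw [← Real.rpow_add_one' ha (by linarith)]
      ring_nf
    have hpow' : m ^ (q - 1) * m = m ^ q := by
      rw [← Real.rpow_add_one' hm (by linarith)]
      ring_nf
    have hnorm : ‖q * |f x + t * g x| ^ (q - 2) * (f x + t * g x) * g x‖ =
        q * (|f x + t * g x| ^ (q - 1) * |g x|) := by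
      rw [← hpow _ (abs_nonneg _), Real.norm_eq_abs, abs_mul, abs_mul, abs_mul, abs_of_pos hq₀,
        abs_of_nonneg (Real.rpow_nonneg (abs_nonneg _) _)]
      ring
    rw [hnorm, abs_of_nonneg hm, ← hpow']
    have := Real.rpow_le_rpow (abs_nonneg _) hy (show 0 ≤ q - 1 by linarith)
    gcongr
  · have hlin : HasDerivAt (fun t : ℝ ↦ f x + t * g x) (g x) t := by
      simpa using ((hasDerivAt_id t).mul_const (g x)).const_add (f x)
    exact (hasDerivAt_abs_rpow _ hq).comp t hlin

/-- If `v₀` minimizes `v ↦ ∫ |u+v|^{p+1} dμ` over a closed subspace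
`N` of `L^{p+1}(μ)` (`p > 1`, `u ∈ L^{p+1}(μ)`), then
`∫ |u+v₀|^{p−1}(u+v₀) u dμ = ∫ |u+v₀|^{p+1} dμ`; in particular this quantity is
nonnegative, and positive whenever `u + v₀` is not `μ`-a.e. zero. -/
theorem stmt15 {Ω : Type*} [MeasurableSpace Ω] (μ : Measure Ω)
    (p : ℝ) (hp : 1 < p) [Fact (1 ≤ ENNReal.ofReal (p + 1))]
    (u v₀ : Lp ℝ (ENNReal.ofReal (p + 1)) μ)
    (N : Submodule ℝ (Lp ℝ (ENNReal.ofReal (p + 1)) μ))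
    (hN : IsClosed (N : Set (Lp ℝ (ENNReal.ofReal (p + 1)) μ)))
    (hv₀ : v₀ ∈ N)
    (hmin : ∀ v ∈ N,
      ∫ x, |(u + v₀ : Lp ℝ (ENNReal.ofReal (p + 1)) μ) x| ^ (p + 1) ∂μ ≤
        ∫ x, |(u + v : Lp ℝ (ENNReal.ofReal (p + 1)) μ) x| ^ (p + 1) ∂μ) :
    (∫ x, |(u + v₀ : Lp ℝ (ENNReal.ofReal (p + 1)) μ) x| ^ (p - 1) *
        ((u + v₀ : Lp ℝ (ENNReal.ofReal (p + 1)) μ) x) * (u x) ∂μ =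
      ∫ x, |(u + v₀ : Lp ℝ (ENNReal.ofReal (p + 1)) μ) x| ^ (p + 1) ∂μ) ∧
    (0 ≤ ∫ x, |(u + v₀ : Lp ℝ (ENNReal.ofReal (p + 1)) μ) x| ^ (p - 1) *
        ((u + v₀ : Lp ℝ (ENNReal.ofReal (p + 1)) μ) x) * (u x) ∂μ) ∧
    (u + v₀ ≠ 0 →
      0 < ∫ x, |(u + v₀ : Lp ℝ (ENNReal.ofReal (p + 1)) μ) x| ^ (p - 1) *
        ((u + v₀ : Lp ℝ (ENNReal.ofReal (p + 1)) μ) x) * (u x) ∂μ) := by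
  have hq : 1 < p + 1 := by linarith
  set w := u + v₀ with hw
  have hw_mem : MemLp w (ENNReal.ofReal (p + 1)) μ := Lp.memLp w
  obtain ⟨hint, hderiv⟩ := hasDerivAt_integral_abs_add_mul_rpow hq hw_mem (Lp.memLp v₀)
  have hwint : Integrable (fun x ↦ |w x| ^ (p + 1)) μ :=
    integrable_abs_rpow (by linarith) hw_mem
  have hlocal : IsLocalMin (fun t : ℝ ↦ ∫ x, |w x + t * v₀ x| ^ (p + 1) ∂μ) 0 := by
    refine .of_forall fun t ↦ ?_
    have h := hmin (v₀ + t • v₀) (N.add_mem hv₀ (N.smul_mem t hv₀))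
    rw [← add_assoc, ← hw] at h
    simp only [zero_mul, add_zero]
    refine h.trans_eq (integral_congr_ae ?_)
    filter_upwards [Lp.coeFn_add w (t • v₀), Lp.coeFn_smul t v₀] with x h₁ h₂
    simp only [h₁, h₂, Pi.add_apply, Pi.smul_apply, smul_eq_mul]
  have hzero := hlocal.hasDerivAt_eq_zero hderiv
  have hp₁ : p + 1 - 2 = p - 1 := by ring
  simp only [hp₁, mul_assoc] at hzero hint
  rw [integral_const_mul] at hzero
  replace hzero := (mul_eq_zero.1 hzero).resolve_left (by linarith)
  replace hint := (integrable_const_mul_iff (IsUnit.mk0 (p + 1) (by linarith)) _).1 hint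
  have heq : ∫ x, |w x| ^ (p - 1) * w x * u x ∂μ = ∫ x, |w x| ^ (p + 1) ∂μ := by
    rw [← sub_zero (∫ x, |w x| ^ (p + 1) ∂μ), ← hzero, ← integral_sub hwint hint]
    refine integral_congr_ae ?_
    filter_upwards [Lp.coeFn_add u v₀] with x hx
    have hu : u x = w x - v₀ x := by
      rw [hw, hx]
      simp
    have hpow : |w x| ^ (p + 1) = |w x| ^ (p - 1) * (w x * w x) := by
      rw [← abs_mul_abs_self (w x), ← mul_assoc, ← Real.rpow_add_one' (abs_nonneg _) (by linarith),
        ← Real.rpow_add_one' (abs_nonneg _) (by linarith)]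
      ring_nf
    simp only [hu, hpow]
    ring
  have hnonneg (x : Ω) : 0 ≤ |w x| ^ (p + 1) := by positivity
  refine ⟨heq, heq ▸ integral_nonneg hnonneg, fun hne ↦ ?_⟩
  rw [heq]
  refine (integral_nonneg hnonneg).lt_of_ne' fun h ↦ hne ?_
  refine (Lp.eq_zero_iff_ae_eq_zero).2 ?_
  filter_upwards [(integral_eq_zero_iff_of_nonneg hnonneg hwint).1 h] with x hx
  simpa [Real.rpow_eq_zero (abs_nonneg (w x)) (by linarith : p + 1 ≠ 0)] using hx
end
end
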